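/- Let H₁ and H₂ be real Hilbert spaces, A : H₁ → H₂ a bounded linear operator, and C ⊆ H₁, Q ⊆ H₂ nonempty, closed and convex subsets. Let f : H₁ → H₁ be monotone on C and Lipschitz continuous on H₁ with constant κ₁ > 0, and let g : H₂ → H₂ be monotone on Q and Lipschitz continuous on H₂ with constant κ₂ > 0; set κ = max{κ₁, κ₂}, so that h(x,y) = (f(x), g(y)) is Lipschitz continuous with constant κ on H = H₁ × H₂. Put D = C × Q and V = {(x,y) ∈ H : Ax = y}, and assume V ∩ SOL(D,h) ≠ ∅. Let {λ_k} ⊆ [a,b] for some 0 < a ≤ b < 1/κ and {α_k} ⊆ [c,d] for some 0 < c ≤ d < 1. Starting from an arbitrary x⁰ ∈ H, define for each k ≥ 0: y^k = P_D(x^k − λ_k h(x^k)), T_k = {w ∈ H : ⟨(x^k − λ_k h(x^k)) − y^k, w − y^k⟩ ≤ 0}, and x^{k+1} = α_k x^k + (1 − α_k) P_V(P_{T_k}(x^k − λ_k h(y^k))). Then {x^k} and {y^k} converge weakly to one and the same point z ∈ V ∩ SOL(D,h), and z = lim_{k→∞} P_{V ∩ SOL(D,h)}(x^k). -/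

import Mathlib

open RealInnerProductSpace

section SvipAux

open Filter Topology

variable {X : Type*} [NormedAddCommGroup X] [InnerProductSpace ℝ X]

/-- Variational characterization of a nearest point. -/
lemma svip_proj_inner {S : Set X} (hS : Convex ℝ S) {x p : X} (hp : p ∈ S)
    (hmin : ∀ y ∈ S, ‖x - p‖ ≤ ‖x - y‖) : ∀ w ∈ S, ⟪x - p, w - p⟫ ≤ 0 := by
  apply (norm_eq_iInf_iff_real_inner_le_zero hS hp).1
  have : Nonempty S := ⟨⟨p, hp⟩⟩
  apply le_antisymm
  · exact le_ciInf fun w => hmin w w.2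
  · exact ciInf_le (f := fun w : S => ‖x - w‖) ⟨0, by rintro _ ⟨w, rfl⟩; exact norm_nonneg _⟩ ⟨p, hp⟩

lemma svip_inner_self_nonpos {v : X} : ⟪v, v⟫ ≤ 0 ↔ v = 0 := by
  rw [real_inner_self_eq_norm_sq]
  constructor
  · intro hv
    exact norm_eq_zero.1 (pow_eq_zero_iff two_ne_zero |>.1 (le_antisymm hv (sq_nonneg _)))
  · rintro rfl
    simp

/-- Pythagorean inequality from the variational characterization. -/
lemma svip_pyth {x p w : X} (hi : ⟪x - p, w - p⟫ ≤ 0) :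
    ‖p - w‖ ^ 2 ≤ ‖x - w‖ ^ 2 - ‖x - p‖ ^ 2 := by
  have e : x - w = (x - p) - (w - p) := by abel
  have e2 : ‖p - w‖ = ‖w - p‖ := norm_sub_rev _ _
  rw [e, e2, norm_sub_sq_real (x - p) (w - p)]
  linarith

/-- The subgradient extragradient estimate. -/
lemma svip_extragradient {u x y z hx hy : X} {l κ : ℝ} (hl : 0 ≤ l)
    (hyu : ⟪hy, u - y⟫ ≤ 0) (hLip : ‖hx - hy‖ ≤ κ * ‖x - y‖)
    (hz : ⟪(x - l • hx) - y, z - y⟫ ≤ 0)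
    (hzu : ⟪(x - l • hy) - z, u - z⟫ ≤ 0) :
    ‖z - u‖ ^ 2 ≤ ‖x - u‖ ^ 2 - (1 - (l * κ) ^ 2) * ‖x - y‖ ^ 2 := by
  have h1 := svip_pyth hzu
  have h2 : ⟪hx - hy, z - y⟫ ≤ κ * ‖x - y‖ * ‖z - y‖ :=
    (real_inner_le_norm _ _).trans (mul_le_mul_of_nonneg_right hLip (norm_nonneg _))
  have h3 := mul_le_mul_of_nonneg_left h2 hl
  have h4 := mul_nonpos_of_nonneg_of_nonpos hl hyu
  have e1 : ‖x - l • hy - u‖ ^ 2 - ‖x - l • hy - z‖ ^ 2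
      = ‖x - u‖ ^ 2 - ‖x - y‖ ^ 2 - ‖z - y‖ ^ 2 + 2 * (l * ⟪hy, u - y⟫)
        + 2 * ⟪(x - l • hx) - y, z - y⟫ + 2 * (l * ⟪hx - hy, z - y⟫) := by
    simp only [← real_inner_self_eq_norm_sq, inner_sub_left, inner_sub_right,
      real_inner_smul_left, real_inner_smul_right]
    rw [real_inner_comm x u, real_inner_comm x y, real_inner_comm x z, real_inner_comm y z,
      real_inner_comm x hy, real_inner_comm u hy, real_inner_comm z hy]
    ring
  nlinarith [sq_nonneg (l * κ * ‖x - y‖ - ‖z - y‖)]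

/-- Convex combination identity. -/
lemma svip_convex_comb (x t u : X) (α : ℝ) :
    ‖α • x + (1 - α) • t - u‖ ^ 2
      = α * ‖x - u‖ ^ 2 + (1 - α) * ‖t - u‖ ^ 2 - α * (1 - α) * ‖x - t‖ ^ 2 := by
  simp only [← real_inner_self_eq_norm_sq, inner_sub_left, inner_sub_right, inner_add_left,
    inner_add_right, real_inner_smul_left, real_inner_smul_right]
  rw [real_inner_comm x u, real_inner_comm x t, real_inner_comm u t]
  ring

/-- Bounded sequences converge weakly along ultrafilters. -/
lemma svip_weak_ultra [CompleteSpace X] (F : Ultrafilter ℕ) (x : ℕ → X) (R : ℝ)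
    (hR : ∀ k, ‖x k‖ ≤ R) :
    ∃ p : X, ∀ w, Tendsto (fun k => ⟪x k, w⟫) F (𝓝 ⟪p, w⟫) := by
  have hb : ∀ w k, |⟪x k, w⟫| ≤ R * ‖w‖ := fun w k =>
    (abs_real_inner_le_norm _ _).trans (mul_le_mul_of_nonneg_right (hR k) (norm_nonneg _))
  have hex : ∀ w, ∃ l : ℝ, Tendsto (fun k => ⟪x k, w⟫) F (𝓝 l) := by
    intro w
    have hc : IsCompact (Set.Icc (-(R * ‖w‖)) (R * ‖w‖)) := isCompact_Icc
    obtain ⟨l, -, hl⟩ := hc.ultrafilter_le_nhds (F.map fun k => ⟪x k, w⟫) (by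
      rw [Ultrafilter.coe_map, le_principal_iff, mem_map]
      exact Filter.univ_mem' fun k => abs_le.1 (hb w k))
    exact ⟨l, hl⟩
  choose l hl using hex
  let L : X →ₗ[ℝ] ℝ :=
    { toFun := l
      map_add' := fun v w => by
        refine tendsto_nhds_unique (hl (v + w)) ?_
        simpa only [inner_add_right] using (hl v).add (hl w)
      map_smul' := fun r w => by
        refine tendsto_nhds_unique (hl (r • w)) ?_
        simpa only [real_inner_smul_right, RingHom.id_apply, smul_eq_mul] using (hl w).const_mul r }
  let M : X →L[ℝ] ℝ := L.mkContinuous R fun w => by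
    change |l w| ≤ _
    exact le_of_tendsto (hl w).abs (Filter.Eventually.of_forall (hb w))
  refine ⟨(InnerProductSpace.toDual ℝ X).symm M, fun w => ?_⟩
  rw [InnerProductSpace.toDual_symm_apply]
  exact hl w

/-- Weakly convergent against strongly convergent. -/
lemma svip_weak_strong {F : Filter ℕ} {x v : ℕ → X} {p q : X} {R : ℝ}
    (hR : ∀ k, ‖x k‖ ≤ R) (hx : ∀ w, Tendsto (fun k => ⟪x k, w⟫) F (𝓝 ⟪p, w⟫))
    (hv : Tendsto v F (𝓝 q)) : Tendsto (fun k => ⟪x k, v k⟫) F (𝓝 ⟪p, q⟫) := by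
  have h0 : Tendsto (fun k => ⟪x k, v k - q⟫) F (𝓝 0) := by
    have h1 : Tendsto (fun k => R * ‖v k - q‖) F (𝓝 0) := by
      have := (tendsto_iff_norm_sub_tendsto_zero.1 hv).const_mul R
      simpa using this
    refine squeeze_zero_norm (fun k => ?_) h1
    exact (norm_inner_le_norm _ _).trans (mul_le_mul_of_nonneg_right (hR k) (norm_nonneg _))
  have := h0.add (hx q)
  simpa [inner_sub_right] using this

/-- Weak convergence is stable under strongly null perturbation. -/
lemma svip_weak_add {F : Filter ℕ} {x v : ℕ → X} {p : X}
    (hx : ∀ w, Tendsto (fun k => ⟪x k, w⟫) F (𝓝 ⟪p, w⟫))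
    (hv : Tendsto (fun k => x k - v k) F (𝓝 0)) (w : X) :
    Tendsto (fun k => ⟪v k, w⟫) F (𝓝 ⟪p, w⟫) := by
  have h1 : Tendsto (fun k => ⟪x k - v k, w⟫) F (𝓝 ⟪(0 : X), w⟫) :=
    hv.inner tendsto_const_nhds
  have := (hx w).sub h1
  simpa [inner_sub_left] using this

/-- Abstract convergence theorem. -/
theorem svip_abstract [CompleteSpace X] (D V SOL : Set X)
    (hDcl : IsClosed D) (hDco : Convex ℝ D) (hVcl : IsClosed V) (hVco : Convex ℝ V)
    (h : X → X) (κ : ℝ) (hκ : 0 < κ)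
    (hmono : ∀ x ∈ D, ∀ y ∈ D, 0 ≤ ⟪h x - h y, x - y⟫)
    (hLip : ∀ x y : X, ‖h x - h y‖ ≤ κ * ‖x - y‖)
    (hSOL : SOL = {u : X | u ∈ D ∧ ∀ w ∈ D, 0 ≤ ⟪h u, w - u⟫})
    (hne : (V ∩ SOL).Nonempty)
    (proj : Set X → X → X)
    (hproj : ∀ S : Set X, S.Nonempty → IsClosed S → Convex ℝ S →
      ∀ x, proj S x ∈ S ∧ ∀ y ∈ S, ‖x - proj S x‖ ≤ ‖x - y‖)
    (lam : ℕ → ℝ) (a b : ℝ) (ha : 0 < a) (hab : a ≤ b) (hb : b < 1 / κ)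
    (hlam : ∀ k, lam k ∈ Set.Icc a b)
    (α : ℕ → ℝ) (c d : ℝ) (hc : 0 < c) (hcd : c ≤ d) (hd : d < 1)
    (hα : ∀ k, α k ∈ Set.Icc c d)
    (x y : ℕ → X) (T : ℕ → Set X)
    (hy : ∀ k, y k = proj D (x k - lam k • h (x k)))
    (hT : ∀ k, T k = {w : X | ⟪(x k - lam k • h (x k)) - y k, w - y k⟫ ≤ 0})
    (hx : ∀ k, x (k + 1) =
      α k • x k + (1 - α k) • proj V (proj (T k) (x k - lam k • h (y k)))) :
    ∃ z ∈ V ∩ SOL,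
      (∀ w : X, Tendsto (fun k => ⟪x k, w⟫) atTop (𝓝 ⟪z, w⟫)) ∧
      (∀ w : X, Tendsto (fun k => ⟪y k, w⟫) atTop (𝓝 ⟪z, w⟫)) ∧
      Tendsto (fun k => proj (V ∩ SOL) (x k)) atTop (𝓝 z) := by
  have hcont : Continuous h :=
    (LipschitzWith.of_dist_le_mul (K := ⟨κ, hκ.le⟩) fun x y => by
      rw [dist_eq_norm, dist_eq_norm]
      exact hLip x y).continuous
  -- Minty
  have hminty : SOL = D ∩ ⋂ w ∈ D, {u : X | 0 ≤ ⟪h w, w - u⟫} := by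
    rw [hSOL]
    ext u
    simp only [Set.mem_ofPred_eq, Set.mem_inter_iff, Set.mem_iInter]
    refine and_congr_right fun huD => ⟨fun H w hw => ?_, fun H w hw => ?_⟩
    · have h1 := hmono w hw u huD
      rw [inner_sub_left] at h1
      linarith [H w hw]
    · have hlim : Tendsto (fun n : ℕ => ⟪h (u + (1 / ((n : ℝ) + 1)) • (w - u)), w - u⟫) atTop
          (𝓝 ⟪h (u + (0 : ℝ) • (w - u)), w - u⟫) := by
        refine Tendsto.inner ?_ tendsto_const_nhds
        refine (hcont.tendsto _).comp ?_
        exact tendsto_const_nhds.add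
          ((tendsto_one_div_add_atTop_nhds_zero_nat (𝕜 := ℝ)).smul_const _)
      simp only [zero_smul, add_zero] at hlim
      refine ge_of_tendsto' hlim fun n => ?_
      have hn : (0 : ℝ) < 1 / ((n : ℝ) + 1) := Nat.one_div_pos_of_nat
      have hn1 : 1 / ((n : ℝ) + 1) ≤ 1 := by
        rw [div_le_one (by positivity)]
        linarith [Nat.cast_nonneg (α := ℝ) n]
      have h1 := H (u + (1 / ((n : ℝ) + 1)) • (w - u))
        (hDco.add_smul_sub_mem huD hw ⟨hn.le, hn1⟩)
      rw [add_sub_cancel_left, real_inner_smul_right] at h1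
      exact nonneg_of_mul_nonneg_right h1 hn
  have hSOLcl : IsClosed SOL := by
    rw [hminty]
    refine hDcl.inter (isClosed_biInter fun w _ => ?_)
    exact isClosed_le continuous_const (by fun_prop)
  have hSOLco : Convex ℝ SOL := by
    rw [hminty]
    refine hDco.inter (convex_iInter₂ fun w _ => ?_)
    intro p hp q hq s t hs ht hst
    simp only [Set.mem_ofPred_eq] at *
    have e : w - (s • p + t • q) = s • (w - p) + t • (w - q) := by
      have : w = (s + t) • w := by rw [hst, one_smul]
      nth_rewrite 1 [this]
      module
    rw [e, inner_add_right, real_inner_smul_right, real_inner_smul_right]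
    positivity
  have hDne : D.Nonempty := by
    obtain ⟨u, -, hu⟩ := hne
    rw [hminty] at hu
    exact ⟨u, hu.1⟩
  have hVne : V.Nonempty := hne.mono Set.inter_subset_left
  have hScl : IsClosed (V ∩ SOL) := hVcl.inter hSOLcl
  have hSco : Convex ℝ (V ∩ SOL) := hVco.inter hSOLco
  have hyD : ∀ k, y k ∈ D := fun k => by
    rw [hy]; exact (hproj D hDne hDcl hDco _).1
  have hyi : ∀ k, ∀ w ∈ D, ⟪(x k - lam k • h (x k)) - y k, w - y k⟫ ≤ 0 := fun k => by
    rw [hy]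
    exact svip_proj_inner hDco (hproj D hDne hDcl hDco _).1 (hproj D hDne hDcl hDco _).2
  have hDT : ∀ k, D ⊆ T k := fun k w hw => by
    rw [hT]; exact hyi k w hw
  have hTcl : ∀ k, IsClosed (T k) := fun k => by
    rw [hT]; exact isClosed_le (by fun_prop) continuous_const
  have hTco : ∀ k, Convex ℝ (T k) := fun k => by
    rw [hT]
    intro p hp q hq s t hs ht hst
    simp only [Set.mem_ofPred_eq] at *
    have e : (s • p + t • q) - y k = s • (p - y k) + t • (q - y k) := by
      have : y k = (s + t) • y k := by rw [hst, one_smul]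
      nth_rewrite 1 [this]
      module
    rw [e, inner_add_right, real_inner_smul_right, real_inner_smul_right]
    nlinarith
  have hTne : ∀ k, (T k).Nonempty := fun k => hDne.mono (hDT k)
  set z : ℕ → X := fun k => proj (T k) (x k - lam k • h (y k)) with hz
  set t : ℕ → X := fun k => proj V (z k) with ht
  have htV : ∀ k, t k ∈ V := fun k => (hproj V hVne hVcl hVco _).1
  have hκb : b * κ < 1 := by rwa [lt_div_iff₀ hκ] at hb
  have hb0 : 0 < b := ha.trans_le hab
  have hbk0 : 0 < b * κ := mul_pos hb0 hκ
  -- main estimate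
  have hmain : ∀ u ∈ V ∩ SOL, ∀ k, ‖x (k + 1) - u‖ ^ 2 +
      ((1 - d) * (1 - (b * κ) ^ 2) * ‖x k - y k‖ ^ 2 + c * (1 - d) * ‖x k - t k‖ ^ 2)
        ≤ ‖x k - u‖ ^ 2 := by
    rintro u ⟨huV, huS⟩ k
    have huS1 := huS
    rw [hminty] at huS1
    have huD : u ∈ D := huS1.1
    have hl := hlam k
    have hak := hα k
    have hzm := hproj (T k) (hTne k) (hTcl k) (hTco k) (x k - lam k • h (y k))
    have e1 : ⟪h (y k), u - y k⟫ ≤ 0 := by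
      have := huS1.2
      simp only [Set.mem_iInter, Set.mem_ofPred_eq] at this
      have := this (y k) (hyD k)
      rw [← neg_sub, inner_neg_right] at this
      linarith
    have e2 : ⟪(x k - lam k • h (x k)) - y k, z k - y k⟫ ≤ 0 := by
      have h2 := hzm.1
      have h3 : ∀ w ∈ T k, ⟪(x k - lam k • h (x k)) - y k, w - y k⟫ ≤ 0 := fun w hw => by
        rw [hT k] at hw
        exact hw
      exact h3 _ h2
    have e3 : ⟪(x k - lam k • h (y k)) - z k, u - z k⟫ ≤ 0 :=
      svip_proj_inner (hTco k) hzm.1 hzm.2 u (hDT k huD)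
    have e4 := svip_extragradient (ha.le.trans hl.1) e1 (hLip (x k) (y k)) e2 e3
    have e5 : ‖t k - u‖ ^ 2 ≤ ‖z k - u‖ ^ 2 - ‖z k - t k‖ ^ 2 := by
      have := hproj V hVne hVcl hVco (z k)
      exact svip_pyth (svip_proj_inner hVco this.1 this.2 u huV)
    have e6 := svip_convex_comb (x k) (t k) u (α k)
    have e7 : (lam k * κ) ^ 2 ≤ (b * κ) ^ 2 := by
      have : 0 ≤ lam k * κ := mul_nonneg (ha.le.trans hl.1) hκ.le
      have : lam k * κ ≤ b * κ := mul_le_mul_of_nonneg_right hl.2 hκ.le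
      gcongr
    have e8 : (b * κ) ^ 2 < 1 := by nlinarith
    have e9 : ‖t k - u‖ ^ 2 ≤ ‖x k - u‖ ^ 2 - (1 - (b * κ) ^ 2) * ‖x k - y k‖ ^ 2 := by
      nlinarith [mul_le_mul_of_nonneg_right e7 (sq_nonneg ‖x k - y k‖), sq_nonneg ‖z k - t k‖]
    have ha1 : 0 ≤ 1 - α k := by linarith [hak.2]
    have e10 := mul_le_mul_of_nonneg_left e9 ha1
    have e11 : (1 - d) * (1 - (b * κ) ^ 2) * ‖x k - y k‖ ^ 2
        ≤ (1 - α k) * (1 - (b * κ) ^ 2) * ‖x k - y k‖ ^ 2 := by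
      apply mul_le_mul_of_nonneg_right _ (sq_nonneg _)
      apply mul_le_mul_of_nonneg_right _ (by linarith)
      linarith [hak.2]
    have e12 : c * (1 - d) * ‖x k - t k‖ ^ 2 ≤ α k * (1 - α k) * ‖x k - t k‖ ^ 2 := by
      apply mul_le_mul_of_nonneg_right _ (sq_nonneg _)
      exact mul_le_mul hak.1 (by linarith [hak.2]) (by linarith) (by linarith [hak.1])
    have e13 : x (k + 1) = α k • x k + (1 - α k) • t k := hx k
    rw [e13, e6]
    linarith
  have hc1 : 0 < (1 - d) * (1 - (b * κ) ^ 2) := by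
    apply mul_pos <;> nlinarith
  have hc2 : 0 < c * (1 - d) := mul_pos hc (by linarith)
  have hfejer : ∀ u ∈ V ∩ SOL, Antitone fun k => ‖x k - u‖ ^ 2 := fun u hu =>
    antitone_nat_of_succ_le fun k => by
      have h1 := hmain u hu k
      have h2 : 0 ≤ (1 - d) * (1 - (b * κ) ^ 2) * ‖x k - y k‖ ^ 2 := by positivity
      have h3 : 0 ≤ c * (1 - d) * ‖x k - t k‖ ^ 2 := by positivity
      linarith
  obtain ⟨u₀, hu₀⟩ := hne
  -- boundedness
  have hbd : ∀ k, ‖x k‖ ≤ ‖x 0 - u₀‖ + ‖u₀‖ := fun k => by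
    have h1 : ‖x k - u₀‖ ≤ ‖x 0 - u₀‖ :=
      (sq_le_sq₀ (norm_nonneg _) (norm_nonneg _)).1 (hfejer u₀ hu₀ (Nat.zero_le k))
    have h2 : ‖x k‖ ≤ ‖x k - u₀‖ + ‖u₀‖ := by
      simpa using norm_add_le (x k - u₀) u₀
    linarith
  -- asymptotic regularity
  have hdiff : Tendsto (fun k => ‖x k - u₀‖ ^ 2 - ‖x (k + 1) - u₀‖ ^ 2) atTop (𝓝 0) := by
    have h1 := tendsto_atTop_ciInf (hfejer u₀ hu₀) ⟨0, by rintro _ ⟨k, rfl⟩; positivity⟩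
    have h2 := h1.sub (h1.comp (tendsto_add_atTop_nat 1))
    simpa using h2
  have hreg : ∀ (v : ℕ → X) (e : ℝ), 0 < e →
      (∀ k, e * ‖x k - v k‖ ^ 2 ≤ ‖x k - u₀‖ ^ 2 - ‖x (k + 1) - u₀‖ ^ 2) →
      Tendsto (fun k => x k - v k) atTop (𝓝 0) := by
    intro v e he hv
    have h1 : Tendsto (fun k => ‖x k - v k‖ ^ 2) atTop (𝓝 0) := by
      have h2 := hdiff.const_mul e⁻¹
      rw [mul_zero] at h2
      refine squeeze_zero (fun k => sq_nonneg _) (fun k => ?_) h2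
      rw [← div_eq_inv_mul, le_div_iff₀ he, mul_comm]
      exact hv k
    have h2 := h1.sqrt
    simp only [Real.sqrt_sq (norm_nonneg _), Real.sqrt_zero] at h2
    exact tendsto_zero_iff_norm_tendsto_zero.2 h2
  have hxy : Tendsto (fun k => x k - y k) atTop (𝓝 0) := hreg y _ hc1 fun k => by
    have h1 := hmain u₀ hu₀ k
    have h3 : 0 ≤ c * (1 - d) * ‖x k - t k‖ ^ 2 := by positivity
    linarith
  have hxt : Tendsto (fun k => x k - t k) atTop (𝓝 0) := hreg t _ hc2 fun k => by
    have h1 := hmain u₀ hu₀ k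
    have h3 : 0 ≤ (1 - d) * (1 - (b * κ) ^ 2) * ‖x k - y k‖ ^ 2 := by positivity
    linarith
  -- strong convergence of projections
  set u : ℕ → X := fun k => proj (V ∩ SOL) (x k) with hu
  have hup := fun k => hproj (V ∩ SOL) ⟨u₀, hu₀⟩ hScl hSco (x k)
  have huS : ∀ k, u k ∈ V ∩ SOL := fun k => (hup k).1
  have hui : ∀ k, ∀ w ∈ V ∩ SOL, ⟪x k - u k, w - u k⟫ ≤ 0 := fun k =>
    svip_proj_inner hSco (hup k).1 (hup k).2
  have hest : ∀ n m, n ≤ m → ‖u m - u n‖ ^ 2 ≤ ‖x n - u n‖ ^ 2 - ‖x m - u m‖ ^ 2 := by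
    intro n m hnm
    have h1 := svip_pyth (hui m (u n) (huS n))
    have h2 := hfejer (u n) (huS n) hnm
    simp only at h2
    linarith
  have hdanti : Antitone fun k => ‖x k - u k‖ ^ 2 := fun n m hnm => by
    have := hest n m hnm
    simp only
    nlinarith [sq_nonneg ‖u m - u n‖]
  have hcauchy : CauchySeq u := by
    have h1 := tendsto_atTop_ciInf hdanti ⟨0, by rintro _ ⟨k, rfl⟩; positivity⟩
    have h2 := h1.cauchySeq
    rw [Metric.cauchySeq_iff'] at h2 ⊢
    intro ε hε
    obtain ⟨N, hN⟩ := h2 (ε ^ 2) (by positivity)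
    refine ⟨N, fun n hn => ?_⟩
    have h3 := hN n hn
    have h4 := hest N n hn
    rw [Real.dist_eq] at h3
    have h5 := neg_abs_le (‖x n - u n‖ ^ 2 - ‖x N - u N‖ ^ 2)
    rw [dist_eq_norm]
    exact lt_of_pow_lt_pow_left₀ 2 hε.le (by linarith)
  obtain ⟨q, hq⟩ := cauchySeq_tendsto_of_complete hcauchy
  have hqS : q ∈ V ∩ SOL := hScl.mem_of_tendsto hq (Eventually.of_forall huS)
  -- weakly closed
  have hwcl : ∀ (S : Set X), IsClosed S → Convex ℝ S → ∀ (F : Ultrafilter ℕ) (v : ℕ → X) (p : X),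
      (∀ k, v k ∈ S) → (∀ w, Tendsto (fun k => ⟪v k, w⟫) F (𝓝 ⟪p, w⟫)) → p ∈ S := by
    intro S hS1 hS2 F v p hv hvp
    have hP := hproj S ⟨v 0, hv 0⟩ hS1 hS2 p
    have hP2 := svip_proj_inner hS2 hP.1 hP.2
    set r := proj S p
    have h1 : Tendsto (fun k => ⟪v k, p - r⟫ - ⟪r, p - r⟫) F (𝓝 (⟪p, p - r⟫ - ⟪r, p - r⟫)) :=
      (hvp (p - r)).sub tendsto_const_nhds
    have h2 : ⟪p, p - r⟫ - ⟪r, p - r⟫ ≤ 0 := le_of_tendsto' h1 fun k => by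
      rw [← inner_sub_left, real_inner_comm]
      exact hP2 _ (hv k)
    rw [← inner_sub_left, svip_inner_self_nonpos, sub_eq_zero] at h2
    rw [h2]; exact hP.1
  -- weak convergence
  have hweak : ∀ w : X, Tendsto (fun k => ⟪x k, w⟫) atTop (𝓝 ⟪q, w⟫) := by
    intro w
    rw [tendsto_iff_ultrafilter]
    intro F hF
    obtain ⟨p, hp⟩ := svip_weak_ultra F x _ hbd
    have hyp := svip_weak_add hp (hxy.mono_left hF)
    have htp := svip_weak_add hp (hxt.mono_left hF)
    have hpV : p ∈ V := hwcl V hVcl hVco F t p htV htp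
    have hpD : p ∈ D := hwcl D hDcl hDco F y p hyD hyp
    have hpS : p ∈ SOL := by
      rw [hminty]
      refine ⟨hpD, ?_⟩
      simp only [Set.mem_iInter, Set.mem_ofPred_eq]
      intro w hw
      have hn : Tendsto (fun k => ‖x k - y k‖) F (𝓝 0) :=
        tendsto_zero_iff_norm_tendsto_zero.1 (hxy.mono_left hF)
      have h1 : Tendsto (fun k => ⟪h w, w⟫ - ⟪y k, h w⟫
          + (1 / a + κ) * (‖x k - y k‖ * (‖w‖ + (‖x 0 - u₀‖ + ‖u₀‖) + ‖x k - y k‖))) F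
          (𝓝 (⟪h w, w⟫ - ⟪p, h w⟫
            + (1 / a + κ) * (0 * (‖w‖ + (‖x 0 - u₀‖ + ‖u₀‖) + 0)))) :=
        (tendsto_const_nhds.sub (hyp (h w))).add
          ((hn.mul (tendsto_const_nhds.add hn)).const_mul _)
      have h2 := ge_of_tendsto' (b := (0 : ℝ)) h1 fun k => by
        have g1 := hmono w hw (y k) (hyD k)
        have g2 := hyi k w hw
        have hlk : 0 < lam k := ha.trans_le (hlam k).1
        have g3 : ‖w - y k‖ ≤ ‖w‖ + (‖x 0 - u₀‖ + ‖u₀‖) + ‖x k - y k‖ := by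
          have e : w - y k = w - x k + (x k - y k) := by abel
          rw [e]
          linarith [norm_add_le (w - x k) (x k - y k), norm_sub_le w (x k), hbd k]
        have g4 : ⟪h (x k) - h (y k), w - y k⟫ ≤ κ * (‖x k - y k‖ * ‖w - y k‖) := by
          rw [← mul_assoc]
          exact (real_inner_le_norm _ _).trans
            (mul_le_mul_of_nonneg_right (hLip _ _) (norm_nonneg _))
        have g5 : -⟪x k - y k, w - y k⟫ ≤ ‖x k - y k‖ * ‖w - y k‖ :=
          (neg_le_abs _).trans (abs_real_inner_le_norm _ _)
        have g6 : ⟪x k - y k, w - y k⟫ ≤ lam k * ⟪h (x k), w - y k⟫ := by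
          have e : x k - lam k • h (x k) - y k = (x k - y k) - lam k • h (x k) := by abel
          rw [e, inner_sub_left, real_inner_smul_left] at g2
          linarith
        have g7 : -(1 / a * (‖x k - y k‖ * ‖w - y k‖)) ≤ ⟪h (x k), w - y k⟫ := by
          have hB : 0 ≤ ‖x k - y k‖ * ‖w - y k‖ := by positivity
          have i1 : -(‖x k - y k‖ * ‖w - y k‖) / lam k ≤ ⟪h (x k), w - y k⟫ := by
            rw [div_le_iff₀ hlk]; linarith
          have i2 : ‖x k - y k‖ * ‖w - y k‖ / lam k ≤ ‖x k - y k‖ * ‖w - y k‖ / a :=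
            div_le_div_of_nonneg_left hB ha (hlam k).1
          rw [neg_div] at i1
          rw [one_div_mul_eq_div]
          linarith
        have g8 : ‖x k - y k‖ * ‖w - y k‖
            ≤ ‖x k - y k‖ * (‖w‖ + (‖x 0 - u₀‖ + ‖u₀‖) + ‖x k - y k‖) :=
          mul_le_mul_of_nonneg_left g3 (norm_nonneg _)
        have g9 := mul_le_mul_of_nonneg_left g8 (show 0 ≤ 1 / a + κ by positivity)
        rw [inner_sub_left] at g1 g4
        have g10 : ⟪h w, w - y k⟫ = ⟪h w, w⟫ - ⟪y k, h w⟫ := by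
          rw [inner_sub_right, real_inner_comm (y k)]
        linarith
      rw [inner_sub_right, real_inner_comm p]
      linarith
    have hpq : p = q := by
      have k1 : Tendsto u F (𝓝 q) := hq.mono_left hF
      have k2 : Tendsto (fun k => p - u k) F (𝓝 (p - q)) := tendsto_const_nhds.sub k1
      have k3 := (svip_weak_strong hbd hp k2).sub (k1.inner k2)
      have k4 : ⟪p, p - q⟫ - ⟪q, p - q⟫ ≤ 0 := le_of_tendsto' k3 fun k => by
        rw [← inner_sub_left]
        exact hui k p ⟨hpV, hpS⟩
      rwa [← inner_sub_left, svip_inner_self_nonpos, sub_eq_zero] at k4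
    rw [← hpq]
    exact hp w
  exact ⟨q, hqS, hweak, svip_weak_add hweak hxy, hq⟩

end SvipAux



/-- Convergence of Algorithm `alg:SubExt4SVIP2` for the SVIP, viewed as a CVIP in the
product Hilbert space `H = H₁ ×₂ H₂` (the product with the ℓ² inner product):
the iterates `x^k, y^k` converge weakly to a common point `z ∈ V ∩ SOL(D, h)`, and
`z` is the strong limit of the projections of the iterates onto `V ∩ SOL(D, h)`. -/
theorem svip_product_algorithm_converges
    {H₁ H₂ : Type*} [NormedAddCommGroup H₁] [InnerProductSpace ℝ H₁] [CompleteSpace H₁]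
    [NormedAddCommGroup H₂] [InnerProductSpace ℝ H₂] [CompleteSpace H₂]
    (A : H₁ →L[ℝ] H₂)
    (C : Set H₁) (Q : Set H₂)
    (hCne : C.Nonempty) (hCcl : IsClosed C) (hCco : Convex ℝ C)
    (hQne : Q.Nonempty) (hQcl : IsClosed Q) (hQco : Convex ℝ Q)
    (f : H₁ → H₁) (g : H₂ → H₂) (κ₁ κ₂ κ : ℝ) (hκ₁ : 0 < κ₁) (hκ₂ : 0 < κ₂)
    (hfmono : ∀ x ∈ C, ∀ y ∈ C, 0 ≤ ⟪f x - f y, x - y⟫)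
    (hgmono : ∀ x ∈ Q, ∀ y ∈ Q, 0 ≤ ⟪g x - g y, x - y⟫)
    (hfLip : ∀ x y : H₁, ‖f x - f y‖ ≤ κ₁ * ‖x - y‖)
    (hgLip : ∀ x y : H₂, ‖g x - g y‖ ≤ κ₂ * ‖x - y‖)
    (hκ : κ = max κ₁ κ₂)
    -- the product-space data: `h (x, y) = (f x, g y)`, `D = C × Q`, `V = {(x,y) | A x = y}`
    (h : WithLp 2 (H₁ × H₂) → WithLp 2 (H₁ × H₂))
    (hh : ∀ p : WithLp 2 (H₁ × H₂), h p = (WithLp.equiv 2 (H₁ × H₂)).symm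
      (f ((WithLp.equiv 2 (H₁ × H₂)) p).1, g ((WithLp.equiv 2 (H₁ × H₂)) p).2))
    (D : Set (WithLp 2 (H₁ × H₂)))
    (hD : D = {p : WithLp 2 (H₁ × H₂) |
      ((WithLp.equiv 2 (H₁ × H₂)) p).1 ∈ C ∧ ((WithLp.equiv 2 (H₁ × H₂)) p).2 ∈ Q})
    (V : Set (WithLp 2 (H₁ × H₂)))
    (hV : V = {p : WithLp 2 (H₁ × H₂) |
      A ((WithLp.equiv 2 (H₁ × H₂)) p).1 = ((WithLp.equiv 2 (H₁ × H₂)) p).2})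
    -- the solution set `SOL(D, h)`
    (SOL : Set (WithLp 2 (H₁ × H₂)))
    (hSOL : SOL = {u : WithLp 2 (H₁ × H₂) | u ∈ D ∧ ∀ w ∈ D, 0 ≤ ⟪h u, w - u⟫})
    (hne : (V ∩ SOL).Nonempty)
    -- a metric projection operator onto nonempty closed convex subsets of the product space
    (proj : Set (WithLp 2 (H₁ × H₂)) → WithLp 2 (H₁ × H₂) → WithLp 2 (H₁ × H₂))
    (hproj : ∀ S : Set (WithLp 2 (H₁ × H₂)), S.Nonempty → IsClosed S → Convex ℝ S →
      ∀ x, proj S x ∈ S ∧ ∀ y ∈ S, ‖x - proj S x‖ ≤ ‖x - y‖)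
    -- the parameters
    (lam : ℕ → ℝ) (a b : ℝ) (ha : 0 < a) (hab : a ≤ b) (hb : b < 1 / κ)
    (hlam : ∀ k, lam k ∈ Set.Icc a b)
    (α : ℕ → ℝ) (c d : ℝ) (hc : 0 < c) (hcd : c ≤ d) (hd : d < 1)
    (hα : ∀ k, α k ∈ Set.Icc c d)
    -- the iterates
    (x y : ℕ → WithLp 2 (H₁ × H₂)) (T : ℕ → Set (WithLp 2 (H₁ × H₂)))
    (hy : ∀ k, y k = proj D (x k - lam k • h (x k)))
    (hT : ∀ k, T k = {w : WithLp 2 (H₁ × H₂) |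
      ⟪(x k - lam k • h (x k)) - y k, w - y k⟫ ≤ 0})
    (hx : ∀ k, x (k + 1) =
      α k • x k + (1 - α k) • proj V (proj (T k) (x k - lam k • h (y k)))) :
    ∃ z ∈ V ∩ SOL,
      (∀ w : WithLp 2 (H₁ × H₂),
        Filter.Tendsto (fun k => ⟪x k, w⟫) Filter.atTop (nhds ⟪z, w⟫)) ∧
      (∀ w : WithLp 2 (H₁ × H₂),
        Filter.Tendsto (fun k => ⟪y k, w⟫) Filter.atTop (nhds ⟪z, w⟫)) ∧
      Filter.Tendsto (fun k => proj (V ∩ SOL) (x k)) Filter.atTop (nhds z) := by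
  have hκ0 : 0 < κ := by rw [hκ]; exact lt_max_of_lt_left hκ₁
  have hf' : Continuous fun p : WithLp 2 (H₁ × H₂) => ((WithLp.equiv 2 (H₁ × H₂)) p).1 :=
    continuous_fst.comp (WithLp.prod_continuous_ofLp 2 H₁ H₂)
  have hs' : Continuous fun p : WithLp 2 (H₁ × H₂) => ((WithLp.equiv 2 (H₁ × H₂)) p).2 :=
    continuous_snd.comp (WithLp.prod_continuous_ofLp 2 H₁ H₂)
  refine svip_abstract D V SOL ?_ ?_ ?_ ?_ h κ hκ0 ?_ ?_ hSOL hne proj hproj lam a b ha hab hb hlam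
    α c d hc hcd hd hα x y T hy hT hx
  · rw [hD]
    exact (hCcl.preimage hf').inter (hQcl.preimage hs')
  · rw [hD]
    intro p hp q hq s t hs ht hst
    exact ⟨hCco hp.1 hq.1 hs ht hst, hQco hp.2 hq.2 hs ht hst⟩
  · rw [hV]
    exact isClosed_eq (A.continuous.comp hf') hs'
  · rw [hV]
    intro p hp q hq s t hs ht hst
    simp only [Set.mem_ofPred_eq, WithLp.equiv_apply] at *
    have hp' : A p.fst = p.snd := hp
    have hq' : A q.fst = q.snd := hq
    simp [hp', hq']
  · rw [hD]
    intro p hp q hq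
    rw [hh, hh, WithLp.prod_inner_apply]
    exact add_nonneg (hfmono _ hp.1 _ hq.1) (hgmono _ hp.2 _ hq.2)
  · intro p q
    have h1 := hfLip p.fst q.fst
    have h2 := hgLip p.snd q.snd
    have m1 : κ₁ ≤ κ := by rw [hκ]; exact le_max_left _ _
    have m2 : κ₂ ≤ κ := by rw [hκ]; exact le_max_right _ _
    have h1' : ‖f p.fst - f q.fst‖ ≤ κ * ‖p.fst - q.fst‖ :=
      h1.trans (mul_le_mul_of_nonneg_right m1 (norm_nonneg _))
    have h2' : ‖g p.snd - g q.snd‖ ≤ κ * ‖p.snd - q.snd‖ :=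
      h2.trans (mul_le_mul_of_nonneg_right m2 (norm_nonneg _))
    refine (sq_le_sq₀ (norm_nonneg _) (by positivity)).1 ?_
    rw [mul_pow, WithLp.prod_norm_sq_eq_of_L2, WithLp.prod_norm_sq_eq_of_L2, hh, hh]
    have s1 := pow_le_pow_left₀ (norm_nonneg _) h1' 2
    have s2 := pow_le_pow_left₀ (norm_nonneg _) h2' 2
    rw [mul_pow] at s1 s2
    change ‖f p.fst - f q.fst‖ ^ 2 + ‖g p.snd - g q.snd‖ ^ 2
      ≤ κ ^ 2 * (‖p.fst - q.fst‖ ^ 2 + ‖p.snd - q.snd‖ ^ 2)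
    linarith
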